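/- arXiv:1410.4384 — 3 statements merged into one kernel-verified Lean document; each statement's English description precedes it below -/
import Mathlib

section
/- Let j ≥ 2 be an integer, α and τ real numbers, and T ≥ 319. Assume the Riemann–von Mangoldt estimate |N(t) − ((t/(2π))·log(t/(2π)) − t/(2π))| ≤ 8.9·log t for all t ≥ 2. Then ∑_{ρ non-trivial zero of ζ, |Im ρ| > T} |1/(ρ+α−τ)^j + 1/(ρ−α−τ)^j| < (8/π)·T^{1−j}·log 2 + (4/π)·T^{1−j}·log T. -/
open Complex Filter Finset

noncomputable section

/-- `ρ` is a non-trivial zero of the Riemann zeta function. -/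
def IsNontrivialZero (ρ : ℂ) : Prop :=
  riemannZeta ρ = 0 ∧ 0 < ρ.re ∧ ρ.re < 1

/-- The multiplicity of `ρ` as a zero of `ζ`. -/
noncomputable def zetaMult (ρ : ℂ) : ℕ :=
  sInf {k : ℕ | iteratedDeriv k riemannZeta ρ ≠ 0}

/-- The zero-counting function `N(t)`: the number of non-trivial zeros `ρ` of `ζ` with
`0 < Im ρ ≤ t`, counted with multiplicity. -/
noncomputable def zetaN (t : ℝ) : ℝ :=
  ∑' ρ : {ρ : ℂ // IsNontrivialZero ρ ∧ 0 < ρ.im ∧ ρ.im ≤ t}, (zetaMult ρ : ℝ)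

/-! ### Conjugation symmetry -/

lemma iteratedDeriv_riemannZeta_conj (k : ℕ) (s : ℂ) :
    iteratedDeriv k riemannZeta (starRingEnd ℂ s) =
      starRingEnd ℂ (iteratedDeriv k riemannZeta s) := by
  induction k generalizing s with
  | zero => simp [riemannZeta_conj]
  | succ k ih =>
    have h : iteratedDeriv k riemannZeta =
        starRingEnd ℂ ∘ iteratedDeriv k riemannZeta ∘ starRingEnd ℂ := by
      funext z
      simp [ih]
    rw [iteratedDeriv_succ]
    conv_lhs => rw [h]
    rw [deriv_conj_conj]
    simp

lemma zetaMult_conj (ρ : ℂ) : zetaMult (starRingEnd ℂ ρ) = zetaMult ρ := by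
  simp [zetaMult, iteratedDeriv_riemannZeta_conj]

lemma isNontrivialZero_conj {ρ : ℂ} :
    IsNontrivialZero (starRingEnd ℂ ρ) ↔ IsNontrivialZero ρ := by
  simp [IsNontrivialZero, riemannZeta_conj]

/-! ### Numerical bounds -/

lemma log_five_bounds :
    (7 * Real.log 2 - 0.024) / 3 ≤ Real.log 5 ∧
      Real.log 5 ≤ (7 * Real.log 2 - 3 / 128) / 3 := by
  have e : Real.log (125 / 128) = 3 * Real.log 5 - 7 * Real.log 2 := by
    rw [Real.log_div (by norm_num) (by norm_num), show (125 : ℝ) = 5 ^ 3 by norm_num,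
      show (128 : ℝ) = 2 ^ 7 by norm_num, Real.log_pow, Real.log_pow]
    norm_num
  have h1 := Real.log_le_sub_one_of_pos (show (0 : ℝ) < 125 / 128 by norm_num)
  have h2 := Real.one_sub_inv_le_log_of_pos (show (0 : ℝ) < 125 / 128 by norm_num)
  rw [e] at h1 h2
  norm_num at h1 h2
  constructor <;> linarith

lemma log_319_le : Real.log 319 ≤ 5.7653 := by
  have e : Real.log 320 = 6 * Real.log 2 + Real.log 5 := by
    rw [show (320 : ℝ) = 2 ^ 6 * 5 by norm_num, Real.log_mul (by norm_num) (by norm_num),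
      Real.log_pow]
    norm_num
  have h1 := Real.log_le_sub_one_of_pos (show (0 : ℝ) < 319 / 320 by norm_num)
  rw [Real.log_div (by norm_num) (by norm_num), e] at h1
  have := log_five_bounds.2
  have := Real.log_two_lt_d9
  norm_num at *
  linarith

lemma le_log_319 : 5.5 ≤ Real.log 319 := by
  have h1 : Real.log (2 ^ 8) ≤ Real.log 319 := Real.log_le_log (by norm_num) (by norm_num)
  rw [Real.log_pow] at h1
  have := Real.log_two_gt_d9
  norm_num at *
  linarith

lemma log_two_pi_bounds :
    1.8376 ≤ Real.log (2 * Real.pi) ∧ Real.log (2 * Real.pi) ≤ 2.1 := by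
  have hπ := Real.pi_gt_d4
  have hπ' := Real.pi_lt_d4
  have e : Real.log (25 / 4) = 2 * Real.log 5 - 2 * Real.log 2 := by
    rw [Real.log_div (by norm_num) (by norm_num), show (25 : ℝ) = 5 ^ 2 by norm_num,
      show (4 : ℝ) = 2 ^ 2 by norm_num, Real.log_pow, Real.log_pow]
    norm_num
  have h2 := Real.one_sub_inv_le_log_of_pos (show (0 : ℝ) < 6.283 / (25 / 4) by norm_num)
  rw [Real.log_div (by norm_num) (by norm_num), e] at h2
  have h3 : Real.log 6.283 ≤ Real.log (2 * Real.pi) :=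
    Real.log_le_log (by norm_num) (by linarith)
  have h4 : Real.log (2 * Real.pi) ≤ Real.log (2 ^ 3) :=
    Real.log_le_log (by positivity) (by linarith)
  rw [Real.log_pow] at h4
  have := log_five_bounds.1
  have := Real.log_two_gt_d9
  have := Real.log_two_lt_d9
  norm_num at *
  constructor <;> linarith

lemma log_le_log_319_add {t : ℝ} (ht : 319 ≤ t) :
    Real.log t ≤ Real.log 319 + (t / 319 - 1) := by
  have h := Real.log_le_sub_one_of_pos (show (0 : ℝ) < t / 319 by positivity)
  rw [Real.log_div (by positivity) (by norm_num)] at h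
  linarith

/-- The Riemann–von Mangoldt estimate for the zero-counting function. -/
def RiemannVonMangoldtBound : Prop :=
  ∀ t : ℝ, 2 ≤ t →
    |zetaN t - (t / (2 * Real.pi) * Real.log (t / (2 * Real.pi)) - t / (2 * Real.pi))| ≤
      8.9 * Real.log t

lemma zetaN_pos (h : RiemannVonMangoldtBound) {t : ℝ} (ht : 319 ≤ t) : 0 < zetaN t := by
  have h1 := (abs_le.1 (h t (by linarith))).1
  rw [Real.log_div (by positivity) (by positivity)] at h1
  have h2 := log_le_log_319_add ht
  have h3 := log_319_le
  have h4 := log_two_pi_bounds.2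
  have h5 : Real.log 319 ≤ Real.log t := Real.log_le_log (by norm_num) ht
  have h6 := le_log_319
  have h7 : t * 0.15 ≤ t / (2 * Real.pi) := by
    rw [le_div_iff₀ (by positivity)]
    nlinarith [Real.pi_lt_d4]
  have h8 : t / (2 * Real.pi) * 2.4 ≤
      t / (2 * Real.pi) * (Real.log t - Real.log (2 * Real.pi) - 1) := by
    gcongr
    linarith
  norm_num at *
  nlinarith

lemma zetaN_two_mul_sub_le (h : RiemannVonMangoldtBound) {t : ℝ} (ht : 319 ≤ t) :
    zetaN (2 * t) - zetaN t ≤ t / (2 * Real.pi) * (Real.log t + 0.692) := by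
  have h1 := (abs_le.1 (h t (by linarith))).1
  have h1' := (abs_le.1 (h (2 * t) (by linarith))).2
  rw [Real.log_div (by positivity) (by positivity)] at h1 h1'
  rw [Real.log_mul (by norm_num) (by positivity)] at h1'
  have h2 := log_le_log_319_add ht
  have h3 := log_319_le
  have h4 := log_two_pi_bounds.1
  have h7 := Real.log_two_lt_d9
  set u := t / (2 * Real.pi) with hu
  have hu0 : 0 < u := by positivity
  have htu : t = u * (2 * Real.pi) := by rw [hu]; field_simp
  have h8 : 2 * t / (2 * Real.pi) = 2 * u := by rw [hu]; ring
  rw [h8] at h1'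
  have h9 : 8.9 * (2 * Real.log t + Real.log 2) ≤ 2.1431 * u := by
    have ha : 2 * Real.log t + Real.log 2 ≤ 12.2238 * (t / 319) := by
      norm_num at *
      linarith
    have hb : t ≤ 6.2832 * u := by
      rw [htu]
      nlinarith [Real.pi_lt_d4]
    norm_num at *
    linarith
  have h10 : u * (2 * Real.log 2 - Real.log (2 * Real.pi) - 1 + 2.1431) ≤ u * 0.692 := by
    gcongr
    norm_num at *
    linarith
  norm_num at *
  linarith

/-! ### Counting zeros -/

lemma summable_zetaMult (h : RiemannVonMangoldtBound) (t : ℝ) :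
    Summable fun ρ : {ρ : ℂ // IsNontrivialZero ρ ∧ 0 < ρ.im ∧ ρ.im ≤ t} =>
      (zetaMult ρ : ℝ) := by
  obtain ⟨M, htM, hM⟩ : ∃ M, t ≤ M ∧ 319 ≤ M := ⟨max t 319, le_max_left _ _, le_max_right _ _⟩
  have hs : Summable fun ρ : {ρ : ℂ // IsNontrivialZero ρ ∧ 0 < ρ.im ∧ ρ.im ≤ M} =>
      (zetaMult ρ : ℝ) := by
    by_contra hn
    have h0 := zetaN_pos h hM
    rw [zetaN, tsum_eq_zero_of_not_summable hn] at h0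
    exact lt_irrefl _ h0
  have hsub : {ρ : ℂ | IsNontrivialZero ρ ∧ 0 < ρ.im ∧ ρ.im ≤ t} ⊆
      {ρ : ℂ | IsNontrivialZero ρ ∧ 0 < ρ.im ∧ ρ.im ≤ M} :=
    fun ρ hρ => ⟨hρ.1, hρ.2.1, hρ.2.2.trans htM⟩
  have hcomp := hs.comp_injective (Set.inclusion_injective hsub)
  exact hcomp

lemma tsum_indicator_zetaMult (h : RiemannVonMangoldtBound) (t : ℝ) :
    ∑' ρ, {ρ : ℂ | IsNontrivialZero ρ ∧ 0 < ρ.im ∧ ρ.im ≤ t}.indicator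
      (fun ρ => (zetaMult ρ : ENNReal)) ρ = ENNReal.ofReal (zetaN t) := by
  rw [← _root_.tsum_subtype, zetaN,
    ENNReal.ofReal_tsum_of_nonneg (fun _ => Nat.cast_nonneg _) (summable_zetaMult h t)]
  simp only [ENNReal.ofReal_natCast]
  rfl

lemma tsum_indicator_dyadic_le (h : RiemannVonMangoldtBound) {t : ℝ} (ht : 319 ≤ t) :
    ∑' ρ, {ρ : ℂ | IsNontrivialZero ρ ∧ t < ρ.im ∧ ρ.im ≤ 2 * t}.indicator
      (fun ρ => (zetaMult ρ : ENNReal)) ρ ≤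
        ENNReal.ofReal (t / (2 * Real.pi) * (Real.log t + 0.692)) := by
  set A := {ρ : ℂ | IsNontrivialZero ρ ∧ t < ρ.im ∧ ρ.im ≤ 2 * t}
  set B := {ρ : ℂ | IsNontrivialZero ρ ∧ 0 < ρ.im ∧ ρ.im ≤ t}
  have hAB : {ρ : ℂ | IsNontrivialZero ρ ∧ 0 < ρ.im ∧ ρ.im ≤ 2 * t} = B ∪ A := by
    ext ρ
    simp only [A, B, Set.mem_union, Set.mem_ofPred_eq]
    constructor
    · rintro ⟨h1, h2, h3⟩
      rcases le_or_gt ρ.im t with h4 | h4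
      · exact Or.inl ⟨h1, h2, h4⟩
      · exact Or.inr ⟨h1, h4, h3⟩
    · rintro (⟨h1, h2, h3⟩ | ⟨h1, h2, h3⟩)
      · exact ⟨h1, h2, by linarith⟩
      · exact ⟨h1, by linarith, h3⟩
  have hd : Disjoint B A := by
    rw [Set.disjoint_left]
    rintro ρ ⟨-, -, h1⟩ ⟨-, h2, -⟩
    exact absurd h1 (not_le.2 h2)
  have e := tsum_indicator_zetaMult h (2 * t)
  rw [hAB, Set.indicator_union_of_disjoint hd, ENNReal.tsum_add,
    tsum_indicator_zetaMult h t] at e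
  refine le_trans ?_ (ENNReal.ofReal_le_ofReal (zetaN_two_mul_sub_le h ht))
  rw [ENNReal.ofReal_sub _ (zetaN_pos h ht).le, ← e,
    ENNReal.add_sub_cancel_left ENNReal.ofReal_ne_top]

/-! ### Tail sums -/

lemma hasSum_dyadic_bound (a b : ℝ) :
    HasSum (fun k : ℕ => (1 / 2 : ℝ) ^ k * (a + k * b)) (2 * a + 2 * b) := by
  have h1 := (hasSum_geometric_of_lt_one (r := (1 / 2 : ℝ)) (by norm_num) (by norm_num)).mul_left a
  have h2 := (hasSum_coe_mul_geometric_of_norm_lt_one (r := (1 / 2 : ℝ))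
    (by norm_num)).mul_left b
  convert! h1.add h2 using 1
  · funext k
    ring
  · norm_num
    ring

lemma tsum_upper_tail_le (h : RiemannVonMangoldtBound) {i : ℕ} (hi : 1 ≤ i) {T : ℝ}
    (hT : 319 ≤ T) :
    ∑' ρ, {ρ : ℂ | IsNontrivialZero ρ ∧ T < ρ.im}.indicator
      (fun ρ => (zetaMult ρ : ENNReal) * ENNReal.ofReal ((ρ.im ^ (i + 1))⁻¹)) ρ ≤
        ENNReal.ofReal ((T ^ i)⁻¹ / Real.pi * (Real.log T + 0.692 + Real.log 2)) := by
  have hT0 : 0 < T := by linarith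
  set D : ℕ → Set ℂ :=
    fun k => {ρ : ℂ | IsNontrivialZero ρ ∧ 2 ^ k * T < ρ.im ∧ ρ.im ≤ 2 * (2 ^ k * T)}
  set g : ℂ → ℕ → ENNReal := fun ρ k =>
    ENNReal.ofReal (((2 ^ k * T) ^ (i + 1))⁻¹) *
      (D k).indicator (fun ρ => (zetaMult ρ : ENNReal)) ρ with hg
  have hpt : ∀ ρ : ℂ, {ρ : ℂ | IsNontrivialZero ρ ∧ T < ρ.im}.indicator
      (fun ρ => (zetaMult ρ : ENNReal) * ENNReal.ofReal ((ρ.im ^ (i + 1))⁻¹)) ρ ≤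
        ∑' k, g ρ k := by
    intro ρ
    refine Set.indicator_le' (g := fun ρ => ∑' k, g ρ k) ?_ (fun _ _ => zero_le) ρ
    rintro ρ ⟨hz, hlt⟩
    have hex : ∃ n : ℕ, ρ.im ≤ 2 ^ n * T := by
      obtain ⟨n, hn⟩ := pow_unbounded_of_one_lt (ρ.im / T) (one_lt_two (α := ℝ))
      exact ⟨n, ((div_lt_iff₀ hT0).1 hn).le⟩
    obtain ⟨k, hk1, hk2⟩ : ∃ k : ℕ, 2 ^ k * T < ρ.im ∧ ρ.im ≤ 2 * (2 ^ k * T) := by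
      obtain ⟨n, hn, hmin⟩ := Nat.findX hex
      cases n with
      | zero => exact absurd hlt (not_lt.2 (by simpa using hn))
      | succ k =>
        refine ⟨k, not_le.1 (hmin k k.lt_succ_self), ?_⟩
        rwa [pow_succ', mul_assoc] at hn
    refine le_trans ?_ (ENNReal.le_tsum k)
    rw [hg]
    dsimp only
    rw [Set.indicator_of_mem (show ρ ∈ D k from ⟨hz, hk1, hk2⟩), mul_comm]
    gcongr
  have hblock : ∀ k, ∑' ρ, g ρ k ≤ ENNReal.ofReal ((T ^ i)⁻¹ / (2 * Real.pi) *
      ((1 / 2 : ℝ) ^ k * (Real.log T + 0.692 + k * Real.log 2))) := by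
    intro k
    have hk1 : (1 : ℝ) ≤ 2 ^ k := one_le_pow₀ (by norm_num)
    have hL : 0 ≤ Real.log T := Real.log_nonneg (by linarith)
    have hL2 : 0 ≤ Real.log 2 := Real.log_nonneg (by norm_num)
    rw [ENNReal.tsum_mul_left]
    refine (mul_le_mul_right (tsum_indicator_dyadic_le h
      (t := 2 ^ k * T) (by nlinarith)) _).trans ?_
    rw [← ENNReal.ofReal_mul (by positivity)]
    refine ENNReal.ofReal_le_ofReal ?_
    rw [Real.log_mul (by positivity) (by positivity), Real.log_pow]
    have e : ((2 ^ k * T) ^ (i + 1))⁻¹ * (2 ^ k * T / (2 * Real.pi) *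
        (k * Real.log 2 + Real.log T + 0.692)) =
        (T ^ i)⁻¹ / (2 * Real.pi) *
          (((2 ^ k) ^ i)⁻¹ * (Real.log T + 0.692 + k * Real.log 2)) := by
      rw [pow_succ, mul_pow]
      field_simp
      ring
    rw [e, one_div, inv_pow]
    gcongr
    exact le_self_pow₀ hk1 (by omega)
  have hs := (hasSum_dyadic_bound (Real.log T + 0.692) (Real.log 2)).mul_left
    ((T ^ i)⁻¹ / (2 * Real.pi))
  calc _ ≤ ∑' ρ, ∑' k, g ρ k := ENNReal.tsum_le_tsum hpt
    _ = ∑' k, ∑' ρ, g ρ k := ENNReal.tsum_comm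
    _ ≤ ∑' k : ℕ, ENNReal.ofReal ((T ^ i)⁻¹ / (2 * Real.pi) *
      ((1 / 2 : ℝ) ^ k * (Real.log T + 0.692 + k * Real.log 2))) :=
        ENNReal.tsum_le_tsum hblock
    _ = _ := by
      have hL : 0 ≤ Real.log T := Real.log_nonneg (by linarith)
      rw [← ENNReal.ofReal_tsum_of_nonneg (fun k => by positivity) hs.summable, hs.tsum_eq]
      congr 1
      field_simp

lemma tsum_tail_le (h : RiemannVonMangoldtBound) {i : ℕ} (hi : 1 ≤ i) {T : ℝ}
    (hT : 319 ≤ T) :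
    ∑' ρ, {ρ : ℂ | IsNontrivialZero ρ ∧ T < |ρ.im|}.indicator
      (fun ρ => (zetaMult ρ : ENNReal) * ENNReal.ofReal ((|ρ.im| ^ (i + 1))⁻¹)) ρ ≤
        2 * ENNReal.ofReal ((T ^ i)⁻¹ / Real.pi * (Real.log T + 0.692 + Real.log 2)) := by
  set F : ℂ → ENNReal := {ρ : ℂ | IsNontrivialZero ρ ∧ T < ρ.im}.indicator
      (fun ρ => (zetaMult ρ : ENNReal) * ENNReal.ofReal ((ρ.im ^ (i + 1))⁻¹)) with hF
  have hpt : ∀ ρ : ℂ, {ρ : ℂ | IsNontrivialZero ρ ∧ T < |ρ.im|}.indicator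
      (fun ρ => (zetaMult ρ : ENNReal) * ENNReal.ofReal ((|ρ.im| ^ (i + 1))⁻¹)) ρ ≤
        F ρ + F (starRingEnd ℂ ρ) := by
    intro ρ
    refine Set.indicator_le' (g := fun ρ => F ρ + F (starRingEnd ℂ ρ)) ?_ (fun _ _ => zero_le) ρ
    rintro ρ ⟨hz, hlt⟩
    rcases le_total 0 ρ.im with h0 | h0
    · rw [abs_of_nonneg h0] at hlt ⊢
      rw [hF, Set.indicator_of_mem (show ρ ∈ {ρ : ℂ | IsNontrivialZero ρ ∧ T < ρ.im} from ⟨hz, hlt⟩)]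
      exact le_self_add
    · rw [abs_of_nonpos h0] at hlt ⊢
      have hmem : starRingEnd ℂ ρ ∈ {ρ : ℂ | IsNontrivialZero ρ ∧ T < ρ.im} :=
        ⟨isNontrivialZero_conj.2 hz, by simpa using hlt⟩
      rw [hF, Set.indicator_of_mem hmem, zetaMult_conj, Complex.conj_im]
      exact le_add_self
  refine (ENNReal.tsum_le_tsum hpt).trans ?_
  have hc : ∑' ρ, F (starRingEnd ℂ ρ) = ∑' ρ, F ρ :=
    Equiv.tsum_eq (starRingAut (R := ℂ)).toEquiv F
  rw [ENNReal.tsum_add, hc, ← two_mul]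
  exact mul_le_mul_right (tsum_upper_tail_le h hi hT) _

lemma norm_one_div_pow_le {z : ℂ} (hz : z.im ≠ 0) (n : ℕ) :
    ‖1 / z ^ n‖ ≤ (|z.im| ^ n)⁻¹ := by
  have := abs_pos.2 hz
  rw [norm_div, norm_one, norm_pow, one_div]
  gcongr
  exact Complex.abs_im_le_norm z

lemma summable_and_tsum_le_of_ennreal {ι : Type*} {f : ι → ℝ} (hf : ∀ x, 0 ≤ f x) {C : ℝ}
    (hC : 0 ≤ C) (h : ∑' x, ENNReal.ofReal (f x) ≤ ENNReal.ofReal C) :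
    Summable f ∧ ∑' x, f x ≤ C := by
  have hs : Summable f := by
    have := ENNReal.summable_toReal (ne_top_of_le_ne_top ENNReal.ofReal_ne_top h)
    simpa only [ENNReal.toReal_ofReal (hf _)] using this
  refine ⟨hs, ?_⟩
  rwa [← ENNReal.ofReal_tsum_of_nonneg hf hs, ENNReal.ofReal_le_ofReal_iff hC] at h

/-- Tail estimate for the sums `∑ |1/(ρ+α−τ)^j + 1/(ρ−α−τ)^j|` over
non-trivial zeros of `ζ` with `|Im ρ| > T`, for `j ≥ 2` and `T ≥ 319`, assuming the
Riemann–von Mangoldt estimate. -/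
theorem zeta_zero_tail_estimate (j : ℕ) (hj : 2 ≤ j) (α τ T : ℝ) (hT : 319 ≤ T)
    (hRvM : ∀ t : ℝ, 2 ≤ t →
      |zetaN t - (t / (2 * Real.pi) * Real.log (t / (2 * Real.pi)) - t / (2 * Real.pi))| ≤
        8.9 * Real.log t) :
    Summable (fun ρ : {ρ : ℂ // IsNontrivialZero ρ ∧ T < |ρ.im|} =>
      (zetaMult ρ : ℝ) *
        ‖1 / ((ρ : ℂ) + α - τ) ^ j + 1 / ((ρ : ℂ) - α - τ) ^ j‖) ∧
    (∑' ρ : {ρ : ℂ // IsNontrivialZero ρ ∧ T < |ρ.im|},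
      (zetaMult ρ : ℝ) *
        ‖1 / ((ρ : ℂ) + α - τ) ^ j + 1 / ((ρ : ℂ) - α - τ) ^ j‖) <
      (8 / Real.pi) * T ^ ((1 : ℤ) - j) * Real.log 2 +
      (4 / Real.pi) * T ^ ((1 : ℤ) - j) * Real.log T := by
  obtain ⟨i, rfl⟩ : ∃ i, j = i + 1 := ⟨j - 1, by omega⟩
  have hL : 0 ≤ Real.log T := Real.log_nonneg (by linarith)
  have hT0 : 0 < T := by linarith
  set f : {ρ : ℂ // IsNontrivialZero ρ ∧ T < |ρ.im|} → ℝ := fun ρ =>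
    (zetaMult ρ : ℝ) *
      ‖1 / ((ρ : ℂ) + α - τ) ^ (i + 1) + 1 / ((ρ : ℂ) - α - τ) ^ (i + 1)‖ with hf
  have hle : ∀ ρ, f ρ ≤ 2 * ((zetaMult ρ : ℝ) * (|(ρ : ℂ).im| ^ (i + 1))⁻¹) := by
    rintro ⟨ρ, -, hlt⟩
    have h0 : ρ.im ≠ 0 := abs_pos.1 (hT0.trans hlt)
    have h1 := norm_one_div_pow_le (z := ρ + α - τ) (by simpa using h0) (i + 1)
    have h2 := norm_one_div_pow_le (z := ρ - α - τ) (by simpa using h0) (i + 1)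
    have e1 : (ρ + α - τ).im = ρ.im := by simp
    have e2 : (ρ - α - τ).im = ρ.im := by simp
    rw [e1] at h1
    rw [e2] at h2
    have h3 := (norm_add_le _ _).trans (add_le_add h1 h2)
    have h4 := mul_le_mul_of_nonneg_left h3 (Nat.cast_nonneg (α := ℝ) (zetaMult ρ))
    simp only [hf]
    linarith
  have htail := tsum_tail_le hRvM (i := i) (by omega) hT
  rw [← _root_.tsum_subtype] at htail
  have hsum : ∑' ρ, ENNReal.ofReal (f ρ) ≤ ENNReal.ofReal
      (4 * ((T ^ i)⁻¹ / Real.pi * (Real.log T + 0.692 + Real.log 2))) := by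
    calc _ ≤ ∑' ρ : {ρ : ℂ // IsNontrivialZero ρ ∧ T < |ρ.im|},
          2 * ((zetaMult ρ : ENNReal) * ENNReal.ofReal ((|(ρ : ℂ).im| ^ (i + 1))⁻¹)) := by
          refine ENNReal.tsum_le_tsum fun ρ => ?_
          refine (ENNReal.ofReal_le_ofReal (hle ρ)).trans_eq ?_
          rw [ENNReal.ofReal_mul (by norm_num), ENNReal.ofReal_mul (by positivity),
            ENNReal.ofReal_natCast, ENNReal.ofReal_ofNat]
      _ ≤ 2 * (2 * ENNReal.ofReal
          ((T ^ i)⁻¹ / Real.pi * (Real.log T + 0.692 + Real.log 2))) := by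
          rw [ENNReal.tsum_mul_left]
          exact mul_le_mul_right htail _
      _ = _ := by
          rw [← mul_assoc, ENNReal.ofReal_mul (p := 4) (by norm_num), ENNReal.ofReal_ofNat]
          norm_num
  have hlog2 := Real.log_two_gt_d9
  obtain ⟨hs, hb⟩ := summable_and_tsum_le_of_ennreal (fun ρ => by positivity)
    (by positivity) hsum
  refine ⟨hs, hb.trans_lt ?_⟩
  have e : T ^ ((1 : ℤ) - ((i + 1 : ℕ) : ℤ)) = (T ^ i)⁻¹ := by
    rw [show (1 : ℤ) - ((i + 1 : ℕ) : ℤ) = -(i : ℤ) by push_cast; ring, zpow_neg, zpow_natCast]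
  rw [e]
  have hc : 0 < (T ^ i)⁻¹ / Real.pi := by positivity
  have h5 : (T ^ i)⁻¹ / Real.pi * (Real.log T + 0.692 + Real.log 2) <
      (T ^ i)⁻¹ / Real.pi * (Real.log T + Real.log 2 + Real.log 2) := by
    gcongr ?_ * ?_
    norm_num at *
    linarith
  calc _ < 4 * ((T ^ i)⁻¹ / Real.pi * (Real.log T + Real.log 2 + Real.log 2)) := by linarith
    _ = _ := by ring

end
end

section
/- Let α and τ be real numbers, let T ≥ 14, and let A ≥ 0 satisfy |Re ρ + α − τ| ≤ A and |Re ρ − α − τ| ≤ A for every non-trivial zero ρ of ζ. Assume N(t) ≤ (5/8)·t·log t for all t ≥ 14 and that ζ has no non-trivial zeros with 0 < Im ρ ≤ 14. Then the symmetric limit R = lim_{U→∞} ∑_{ρ non-trivial zero of ζ, T < |Im ρ| ≤ U} (1/(ρ+α−τ) + 1/(ρ−α−τ)) exists and satisfies |R| ≤ 5A·(log T + 1)/T ≤ (15/2)·A·(log T)/T. -/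
open Complex Filter Finset

noncomputable section

lemma iteratedDeriv_conj_of_comm {f : ℂ → ℂ} (hf : ∀ z, f (starRingEnd ℂ z) = starRingEnd ℂ (f z))
    (k : ℕ) (z : ℂ) :
    iteratedDeriv k f (starRingEnd ℂ z) = starRingEnd ℂ (iteratedDeriv k f z) := by
  induction k generalizing z with
  | zero => simpa using hf z
  | succ k ih =>
    rw [iteratedDeriv_succ]
    have h : starRingEnd ℂ ∘ iteratedDeriv k f ∘ starRingEnd ℂ = iteratedDeriv k f := by
      funext w
      simp [ih]
    have h' := congrFun (deriv_conj_conj (f := iteratedDeriv k f)) (starRingEnd ℂ z)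
    rw [h] at h'
    simpa using h'

lemma norm_one_div_add_one_div_le {w v : ℂ} {B : ℝ} (hre : v.re = w.re) (him : v.im = -w.im)
    (hw : w.im ≠ 0) (hB : |w.re| ≤ B) : ‖1 / w + 1 / v‖ ≤ 2 * B / w.im ^ 2 := by
  have hv : v = starRingEnd ℂ w := Complex.ext hre him
  have hw0 : w ≠ 0 := fun h ↦ hw (by simp [h])
  have hv0 : starRingEnd ℂ w ≠ 0 := by simpa using hw0
  have h : 1 / w + 1 / v = ((2 * w.re / normSq w : ℝ) : ℂ) := by
    rw [hv, div_add_div _ _ hw0 hv0, mul_conj, one_mul, mul_one, add_comm, add_conj]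
    push_cast
    rfl
  rw [h, norm_real, Real.norm_eq_abs, abs_div, abs_mul, abs_two, abs_of_nonneg (normSq_nonneg w)]
  have hpos : 0 < w.im ^ 2 := by positivity
  have hle : w.im ^ 2 ≤ normSq w := by
    rw [normSq_apply]
    nlinarith [mul_self_nonneg w.re]
  have : 0 ≤ B := (abs_nonneg _).trans hB
  gcongr

open MeasureTheory Set in
/-- Partial summation: a bound `c * t * log t` for the counting function of the points `γ i > T`
bounds the weighted sum of `1 / γ i ^ 2`. -/
lemma sum_div_sq_le_of_count_le {ι : Type*} (s : Finset ι) (m γ : ι → ℝ) {c T : ℝ}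
    (hT : 1 ≤ T) (hγ : ∀ i ∈ s, T < γ i)
    (hcount : ∀ t, T < t → ∑ i ∈ s with γ i < t, m i ≤ c * t * Real.log t) :
    ∑ i ∈ s, m i / γ i ^ 2 ≤ 2 * c * (Real.log T + 1) / T := by
  have hcube (a : ℝ) (ha : 0 < a) :
      IntegrableOn (fun t : ℝ ↦ 2 / t ^ 3) (Ioi a) ∧ ∫ t in Ioi a, 2 / t ^ 3 = 1 / a ^ 2 := by
    have hd : ∀ t ∈ Ici a, HasDerivAt (fun t : ℝ ↦ -(t ^ 2)⁻¹) (2 / t ^ 3) t := by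
      intro t ht
      have ht0 : t ≠ 0 := (ha.trans_le ht).ne'
      convert! ((hasDerivAt_pow 2 t).inv (by positivity)).neg using 1
      field_simp
      ring
    have hpos : ∀ t ∈ Ioi a, 0 ≤ 2 / t ^ 3 := fun t ht ↦ by
      have : 0 < t := ha.trans ht
      positivity
    have hlim : Tendsto (fun t : ℝ ↦ -(t ^ 2)⁻¹) atTop (nhds 0) := by
      simpa using ((tendsto_pow_atTop (α := ℝ) two_ne_zero).inv_tendsto_atTop).neg
    refine ⟨integrableOn_Ioi_deriv_of_nonneg' hd hpos hlim, ?_⟩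
    rw [integral_Ioi_of_hasDerivAt_of_nonneg' hd hpos hlim]
    simp
  have hlog : IntegrableOn (fun t : ℝ ↦ Real.log t / t ^ 2) (Ioi T) ∧
      ∫ t in Ioi T, Real.log t / t ^ 2 = (Real.log T + 1) / T := by
    have hd : ∀ t ∈ Ici T,
        HasDerivAt (fun t : ℝ ↦ -((Real.log t + 1) / t)) (Real.log t / t ^ 2) t := by
      intro t ht
      have ht0 : t ≠ 0 := (zero_lt_one.trans_le (hT.trans ht)).ne'
      convert! (((Real.hasDerivAt_log ht0).add_const 1).div (hasDerivAt_id t) ht0).neg using 1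
      simp only [id]
      field_simp
      ring
    have hpos : ∀ t ∈ Ioi T, 0 ≤ Real.log t / t ^ 2 := fun t ht ↦ by
      have := Real.log_nonneg (hT.trans (le_of_lt ht))
      positivity
    have hlim : Tendsto (fun t : ℝ ↦ -((Real.log t + 1) / t)) atTop (nhds 0) := by
      have h := (Real.isLittleO_log_id_atTop.tendsto_div_nhds_zero.add
        tendsto_inv_atTop_zero).neg
      simpa [add_div] using h
    refine ⟨integrableOn_Ioi_deriv_of_nonneg' hd hpos hlim, ?_⟩
    rw [integral_Ioi_of_hasDerivAt_of_nonneg' hd hpos hlim]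
    simp
  let φ (i : ι) (t : ℝ) : ℝ := m i * (Ioi (γ i)).indicator (fun t ↦ 2 / t ^ 3) t
  have hT0 : 0 < T := by linarith
  have hφ (i) (hi : i ∈ s) : IntegrableOn (φ i) (Ioi T) :=
    (((hcube (γ i) (hT0.trans (hγ i hi))).1.integrable_indicator measurableSet_Ioi).const_mul
      _).integrableOn
  calc ∑ i ∈ s, m i / γ i ^ 2 = ∑ i ∈ s, ∫ t in Ioi T, φ i t := by
        refine Finset.sum_congr rfl fun i hi ↦ ?_
        rw [integral_const_mul, setIntegral_indicator measurableSet_Ioi, Ioi_inter_Ioi,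
          sup_of_le_right (hγ i hi).le, (hcube (γ i) (hT0.trans (hγ i hi))).2, mul_one_div]
    _ = ∫ t in Ioi T, ∑ i ∈ s, φ i t := (integral_finsetSum s hφ).symm
    _ ≤ ∫ t in Ioi T, 2 * c * (Real.log t / t ^ 2) := by
        refine setIntegral_mono_on (integrable_finsetSum s hφ) (hlog.1.const_mul _)
          measurableSet_Ioi fun t ht ↦ ?_
        have ht0 : 0 < t := hT0.trans ht
        have h : ∑ i ∈ s, φ i t = (∑ i ∈ s with γ i < t, m i) * (2 / t ^ 3) := by
          rw [Finset.sum_filter, Finset.sum_mul]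
          refine Finset.sum_congr rfl fun i _ ↦ ?_
          by_cases hi : γ i < t <;> simp [φ, hi]
        rw [h]
        calc _ ≤ c * t * Real.log t * (2 / t ^ 3) := by
              gcongr
              exact hcount t ht
          _ = _ := by field_simp
    _ = 2 * c * (Real.log T + 1) / T := by
        rw [integral_const_mul, hlog.2, mul_div_assoc]

lemma finite_isNontrivialZero_abs_im_le (U : ℝ) :
    {ρ : ℂ | IsNontrivialZero ρ ∧ |ρ.im| ≤ U}.Finite := by
  have hK : IsCompact (Set.Icc (0 : ℝ) 1 ×ℂ Set.Icc (-U) U) := isCompact_Icc.reProdIm isCompact_Icc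
  refine hK.inter_riemannZetaZeros_finite.subset fun ρ hρ ↦ ?_
  exact ⟨mem_reProdIm.2 ⟨⟨hρ.1.2.1.le, hρ.1.2.2.le⟩, abs_le.1 hρ.2⟩, hρ.1.1⟩

lemma sum_zetaMult_le_zetaN (s : Finset ℂ) (t : ℝ)
    (hs : ∀ ρ ∈ s, IsNontrivialZero ρ ∧ 0 < ρ.im ∧ ρ.im ≤ t) :
    ∑ ρ ∈ s, (zetaMult ρ : ℝ) ≤ zetaN t := by
  let S : Set ℂ := {ρ | IsNontrivialZero ρ ∧ 0 < ρ.im ∧ ρ.im ≤ t}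
  have hfin : S.Finite := (finite_isNontrivialZero_abs_im_le t).subset fun ρ hρ ↦
    ⟨hρ.1, by rw [abs_of_pos hρ.2.1]; exact hρ.2.2⟩
  have heq : zetaN t = ∑' ρ, S.indicator (fun ρ ↦ (zetaMult ρ : ℝ)) ρ :=
    tsum_subtype S fun ρ ↦ (zetaMult ρ : ℝ)
  rw [heq]
  calc ∑ ρ ∈ s, (zetaMult ρ : ℝ) = ∑ ρ ∈ s, S.indicator (fun ρ ↦ (zetaMult ρ : ℝ)) ρ :=
        Finset.sum_congr rfl fun ρ hρ ↦ by
          rw [Set.indicator_of_mem (s := S) (hs ρ hρ)]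
    _ ≤ _ := by
        refine Summable.sum_le_tsum s (fun ρ _ ↦ ?_) ?_
        · exact Set.indicator_nonneg (fun _ _ ↦ by positivity) ρ
        · exact summable_of_hasFiniteSupport (hfin.subset Set.support_indicator_subset)

/-- A sum over the zeros with `T < |Im ρ| ≤ U` folds along complex conjugation. -/
lemma tsum_abs_im_eq_tsum_im (f : ℂ → ℂ) {T : ℝ} (hT : 0 ≤ T) (U : ℝ) :
    ∑' ρ : {ρ : ℂ // IsNontrivialZero ρ ∧ T < |ρ.im| ∧ |ρ.im| ≤ U}, f ρ =
      ∑' ρ : {ρ : ℂ // IsNontrivialZero ρ ∧ T < ρ.im ∧ ρ.im ≤ U},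
        (f ρ + f (starRingEnd ℂ ρ)) := by
  let S : Set ℂ := {ρ | IsNontrivialZero ρ ∧ T < ρ.im ∧ ρ.im ≤ U}
  have hfin : S.Finite := (finite_isNontrivialZero_abs_im_le U).subset fun ρ hρ ↦
    ⟨hρ.1, by rw [abs_of_pos (hT.trans_lt hρ.2.1)]; exact hρ.2.2⟩
  have hunion : {ρ : ℂ | IsNontrivialZero ρ ∧ T < |ρ.im| ∧ |ρ.im| ≤ U} =
      S ∪ starRingEnd ℂ '' S := by
    ext ρ
    constructor
    · rintro ⟨hz, h1, h2⟩
      rcases le_total 0 ρ.im with h | h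
      · rw [abs_of_nonneg h] at h1 h2
        exact Or.inl ⟨hz, h1, h2⟩
      · rw [abs_of_nonpos h] at h1 h2
        exact Or.inr ⟨starRingEnd ℂ ρ, ⟨isNontrivialZero_conj.2 hz, by simpa, by simpa⟩, by simp⟩
    · rintro (⟨hz, h1, h2⟩ | ⟨w, ⟨hz, h1, h2⟩, rfl⟩)
      · exact ⟨hz, by rwa [abs_of_pos (hT.trans_lt h1)], by rwa [abs_of_pos (hT.trans_lt h1)]⟩
      · refine ⟨isNontrivialZero_conj.2 hz, ?_, ?_⟩ <;>
          rwa [conj_im, abs_neg, abs_of_pos (hT.trans_lt h1)]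
  have hdisj : Disjoint S (starRingEnd ℂ '' S) := by
    rw [Set.disjoint_left]
    rintro _ h ⟨w, hw, rfl⟩
    have h1 := h.2.1
    have h2 := hw.2.1
    rw [conj_im] at h1
    linarith
  have := hfin.to_subtype
  have := (hfin.image (starRingEnd ℂ)).to_subtype
  calc _ = ∑' ρ : ↑(S ∪ starRingEnd ℂ '' S), f ρ := tsum_congr_set_coe f hunion
    _ = ∑' ρ : S, f ρ + ∑' ρ : ↑(starRingEnd ℂ '' S), f ρ :=
        Summable.tsum_union_disjoint hdisj Summable.of_finite Summable.of_finite
    _ = ∑' ρ : S, f ρ + ∑' ρ : S, f (starRingEnd ℂ ρ) := by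
        rw [tsum_image f (starRingEnd ℂ).injective.injOn]
    _ = _ := (Summable.tsum_add Summable.of_finite Summable.of_finite).symm

/-- For real `α`, `τ`, `T ≥ 14` and `A` bounding `|Re ρ ± α − τ|` over the
non-trivial zeros of `ζ`, assuming `N(t) ≤ (5/8)·t·log t` for `t ≥ 14` and that there are no
zeros with `0 < Im ρ ≤ 14`, the symmetric limit
`R = lim_{U→∞} ∑_{T<|Im ρ|≤U} (1/(ρ+α−τ) + 1/(ρ−α−τ))` exists and
`|R| ≤ 5A(log T + 1)/T ≤ (15/2)·A·(log T)/T`. -/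
theorem linear_tail_estimate (α τ T : ℝ) (hT : 14 ≤ T) (A : ℝ) (hA : 0 ≤ A)
    (hAbd : ∀ ρ : ℂ, IsNontrivialZero ρ → |ρ.re + α - τ| ≤ A ∧ |ρ.re - α - τ| ≤ A)
    (hN : ∀ t : ℝ, 14 ≤ t → zetaN t ≤ (5 / 8) * t * Real.log t)
    (hlow : ∀ ρ : ℂ, IsNontrivialZero ρ → ¬(0 < ρ.im ∧ ρ.im ≤ 14)) :
    ∃ R : ℂ,
      Filter.Tendsto (fun U : ℝ =>
          ∑' ρ : {ρ : ℂ // IsNontrivialZero ρ ∧ T < |ρ.im| ∧ |ρ.im| ≤ U},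
            (zetaMult ρ : ℂ) *
              (1 / ((ρ : ℂ) + α - τ) + 1 / ((ρ : ℂ) - α - τ)))
        Filter.atTop (nhds R) ∧
      ‖R‖ ≤ 5 * A * (Real.log T + 1) / T ∧
      5 * A * (Real.log T + 1) / T ≤ (15 / 2) * A * Real.log T / T := by
  have hT0 : 0 < T := by linarith
  let f (ρ : ℂ) : ℂ := (zetaMult ρ : ℂ) * (1 / (ρ + α - τ) + 1 / (ρ - α - τ))
  let S : Set ℂ := {ρ | IsNontrivialZero ρ ∧ T < ρ.im}
  let G : ℂ → ℂ := S.indicator fun ρ ↦ f ρ + f (starRingEnd ℂ ρ)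
  have hfold (ρ : ℂ) (hρ : ρ ∈ S) :
      ‖f ρ + f (starRingEnd ℂ ρ)‖ ≤ 4 * A * (zetaMult ρ / ρ.im ^ 2) := by
    have him : ρ.im ≠ 0 := (hT0.trans hρ.2).ne'
    have h1 := norm_one_div_add_one_div_le (w := ρ + α - τ) (v := starRingEnd ℂ ρ + α - τ)
      (B := A) (by simp) (by simp) (by simpa using him) (by simpa using (hAbd ρ hρ.1).1)
    have h2 := norm_one_div_add_one_div_le (w := ρ - α - τ) (v := starRingEnd ℂ ρ - α - τ)
      (B := A) (by simp) (by simp) (by simpa using him) (by simpa using (hAbd ρ hρ.1).2)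
    have e1 : (ρ + α - τ).im = ρ.im := by simp
    have e2 : (ρ - α - τ).im = ρ.im := by simp
    rw [e1] at h1
    rw [e2] at h2
    calc ‖f ρ + f (starRingEnd ℂ ρ)‖
        = ‖(zetaMult ρ : ℂ) * ((1 / (ρ + α - τ) + 1 / (starRingEnd ℂ ρ + α - τ)) +
            (1 / (ρ - α - τ) + 1 / (starRingEnd ℂ ρ - α - τ)))‖ := by
          simp only [f, zetaMult_conj]
          ring_nf
      _ ≤ zetaMult ρ * (2 * A / ρ.im ^ 2 + 2 * A / ρ.im ^ 2) := by
          rw [norm_mul, norm_natCast]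
          gcongr
          exact (norm_add_le _ _).trans (add_le_add h1 h2)
      _ = 4 * A * (zetaMult ρ / ρ.im ^ 2) := by ring
  have hsum (s : Finset ℂ) : ∑ ρ ∈ s, ‖G ρ‖ ≤ 5 * A * (Real.log T + 1) / T := by
    classical
    have hmem (ρ : ℂ) (hρ : ρ ∈ s.filter (· ∈ S)) : ρ ∈ S := (Finset.mem_filter.1 hρ).2
    have htail := sum_div_sq_le_of_count_le (s.filter (· ∈ S)) (fun ρ ↦ (zetaMult ρ : ℝ))
      Complex.im (c := 5 / 8) (T := T) (by linarith) (fun ρ hρ ↦ (hmem ρ hρ).2) fun t ht ↦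
        (sum_zetaMult_le_zetaN _ t fun ρ hρ ↦ by
          have hρ' := Finset.mem_filter.1 hρ
          have hS := hmem ρ hρ'.1
          exact ⟨hS.1, hT0.trans hS.2, hρ'.2.le⟩).trans (hN t (hT.trans ht.le))
    calc ∑ ρ ∈ s, ‖G ρ‖ = ∑ ρ ∈ s.filter (· ∈ S), ‖f ρ + f (starRingEnd ℂ ρ)‖ := by
          rw [Finset.sum_filter]
          refine Finset.sum_congr rfl fun ρ _ ↦ ?_
          by_cases h : ρ ∈ S <;> simp [G, h]
      _ ≤ ∑ ρ ∈ s.filter (· ∈ S), 4 * A * (zetaMult ρ / ρ.im ^ 2) :=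
          Finset.sum_le_sum fun ρ hρ ↦ hfold ρ (hmem ρ hρ)
      _ ≤ 4 * A * (2 * (5 / 8) * (Real.log T + 1) / T) := by
          rw [← Finset.mul_sum]
          gcongr
      _ = 5 * A * (Real.log T + 1) / T := by ring
  have hsummable : Summable fun ρ ↦ ‖G ρ‖ := summable_of_sum_le (fun ρ ↦ norm_nonneg _) hsum
  refine ⟨∑' ρ, G ρ, ?_, ?_, ?_⟩
  · have hlim : Tendsto (fun U : ℝ ↦ ∑' ρ, {ρ : ℂ | ρ.im ≤ U}.indicator G ρ) atTop
        (nhds (∑' ρ, G ρ)) := by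
      refine tendsto_tsum_of_dominated_convergence hsummable (fun ρ ↦ ?_)
        (Eventually.of_forall fun U ρ ↦ norm_indicator_le_norm_self _ _)
      refine tendsto_const_nhds.congr' ?_
      filter_upwards [eventually_ge_atTop ρ.im] with U hU
      exact (Set.indicator_of_mem (s := {ρ : ℂ | ρ.im ≤ U}) hU G).symm
    refine hlim.congr fun U ↦ ?_
    rw [tsum_abs_im_eq_tsum_im f hT0.le U]
    refine Eq.trans (tsum_congr fun ρ ↦ ?_) (tsum_subtype
      {ρ : ℂ | IsNontrivialZero ρ ∧ T < ρ.im ∧ ρ.im ≤ U}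
      fun ρ ↦ f ρ + f (starRingEnd ℂ ρ)).symm
    rw [Set.indicator_indicator]
    congr 1
    ext z
    simp only [S, Set.mem_inter_iff, Set.mem_ofPred_eq]
    tauto
  · exact (norm_tsum_le_tsum_norm hsummable).trans
      (hsummable.tsum_le_of_sum_le hsum)
  · have hlog : 2 ≤ Real.log T := by
      rw [Real.le_log_iff_exp_le hT0]
      have h : Real.exp 2 = Real.exp 1 ^ 2 := by rw [← Real.exp_nat_mul]; norm_num
      rw [h]
      nlinarith [Real.exp_one_lt_d9, Real.exp_pos 1]
    have h : 5 * A * (Real.log T + 1) ≤ 15 / 2 * A * Real.log T := by nlinarith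
    gcongr

end
end

section
/- Let t0 ≥ 1, C > 0, 0 < ϑ < 1, and τ > 0 be real numbers. Let (ρ_k)_{k∈I} be a family of complex numbers (indexed by a countable set I, allowing repetitions) with Im ρ_k ≥ t0 and Re ρ_k ≤ τ/2 for all k, and such that #{k ∈ I : Im ρ_k ≤ t} ≤ C·t·log t for every t ≥ t0. Let (ρ'_k)_{k∈I} satisfy Re ρ'_k = Re ρ_k and |ρ_k − ρ'_k| ≤ ϑ for all k. Then for every positive integer n and every real T, |∑_{k ∈ I, Im ρ_k ≤ T} [((ρ_k/(ρ_k−τ))^n − (ρ'_k/(ρ'_k−τ))^n) + ((conj ρ_k/(conj ρ_k−τ))^n − (conj ρ'_k/(conj ρ'_k−τ))^n)]| ≤ 4·C·ϑ·n·τ·(1 + log t0)/(t0·(1−ϑ)). -/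
open Complex Filter

noncomputable section

/-- One step of Abel summation for `∑ γ⁻²`, against the antiderivative `-(1 + log t) / t` of
`log t / t ^ 2`. -/
lemma abel_step {N C a b : ℝ} (hC : 0 ≤ C) (ha : 1 ≤ a) (hab : a ≤ b)
    (hN : N ≤ C * a * Real.log a) :
    N / a ^ 2 + 2 * C * ((1 + Real.log b) / b) ≤ N / b ^ 2 + 2 * C * ((1 + Real.log a) / a) := by
  have ha0 : 0 < a := by linarith
  have hb0 : 0 < b := by linarith
  have hlog : Real.log b ≤ Real.log a + (b / a - 1) := by
    have h := Real.log_le_sub_one_of_pos (div_pos hb0 ha0)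
    rw [Real.log_div hb0.ne' ha0.ne'] at h
    linarith
  have hL : 0 ≤ Real.log a := Real.log_nonneg ha
  have hinv : 0 ≤ 1 / a ^ 2 - 1 / b ^ 2 :=
    sub_nonneg.2 (one_div_le_one_div_of_le (by positivity) (by gcongr))
  have h1 := mul_le_mul_of_nonneg_right hN hinv
  have h2 : 2 * C * ((1 + Real.log b) / b) ≤
      2 * C * ((1 + (Real.log a + (b / a - 1))) / b) := by gcongr
  have h3 : 0 ≤ C * Real.log a * (b - a) ^ 2 / (a * b ^ 2) := by positivity
  have h4 : 2 * C * ((1 + Real.log a) / a) - 2 * C * ((1 + (Real.log a + (b / a - 1))) / b)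
      - C * a * Real.log a * (1 / a ^ 2 - 1 / b ^ 2) =
      C * Real.log a * (b - a) ^ 2 / (a * b ^ 2) := by
    field_simp
    ring
  have h5 : N * (1 / a ^ 2 - 1 / b ^ 2) = N / a ^ 2 - N / b ^ 2 := by ring
  linarith

lemma sum_inv_sq_le_aux {J : Type*} (γ : J → ℝ) {t0 C : ℝ} (ht0 : 1 ≤ t0)
    (hC : 0 ≤ C) (hγ : ∀ k, t0 ≤ γ k) (S : Finset J) :
    (∀ t, t0 ≤ t → ((S.filter (fun k => γ k ≤ t)).card : ℝ) ≤ C * t * Real.log t) →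
    ∀ t, t0 ≤ t → (∀ k ∈ S, γ k ≤ t) →
      ∑ k ∈ S, 1 / γ k ^ 2 + 2 * C * ((1 + Real.log t) / t) ≤
        S.card / t ^ 2 + 2 * C * ((1 + Real.log t0) / t0) := by
  classical
  induction S using Finset.induction_on_max_value γ with
  | empty =>
    intro _ t ht _
    have hN : (0 : ℝ) ≤ C * t0 * Real.log t0 := by
      have := Real.log_nonneg ht0
      positivity
    simpa using abel_step hC ht0 ht hN
  | insert a s has hmax ih =>
    intro hcount t ht hle
    have hs : ∑ k ∈ s, 1 / γ k ^ 2 + 2 * C * ((1 + Real.log (γ a)) / γ a) ≤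
        s.card / γ a ^ 2 + 2 * C * ((1 + Real.log t0) / t0) := by
      refine ih (fun u hu => le_trans ?_ (hcount u hu)) (γ a) (hγ a) hmax
      exact_mod_cast Finset.card_le_card
        (Finset.filter_subset_filter _ (Finset.subset_insert a s))
    have hN := hcount (γ a) (hγ a)
    rw [Finset.filter_true_of_mem (by
      intro k hk
      rcases Finset.mem_insert.1 hk with rfl | hk
      · exact le_rfl
      · exact hmax k hk)] at hN
    have hstep := abel_step hC (ht0.trans (hγ a)) (hle a (Finset.mem_insert_self a s)) hN
    rw [Finset.sum_insert has]
    have hcard : ((insert a s).card : ℝ) / γ a ^ 2 = s.card / γ a ^ 2 + 1 / γ a ^ 2 := by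
      rw [Finset.card_insert_of_notMem has]
      push_cast
      ring
    linarith

/-- If the counting function of `γ` on `S` is at most `C t log t`, then
`∑ γ⁻² ≤ 2 C (1 + log t0) / t0`. -/
lemma sum_inv_sq_le {J : Type*} (γ : J → ℝ) {t0 C : ℝ} (ht0 : 1 ≤ t0)
    (hC : 0 ≤ C) (hγ : ∀ k, t0 ≤ γ k) (S : Finset J)
    (hcount : ∀ t, t0 ≤ t → ((S.filter (fun k => γ k ≤ t)).card : ℝ) ≤ C * t * Real.log t)
    {t : ℝ} (ht : t0 ≤ t) (hle : ∀ k ∈ S, γ k ≤ t) :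
    ∑ k ∈ S, 1 / γ k ^ 2 ≤ 2 * C * ((1 + Real.log t0) / t0) := by
  have h := sum_inv_sq_le_aux γ ht0 hC hγ S hcount t ht hle
  have hN := hcount t ht
  rw [Finset.filter_true_of_mem hle] at hN
  have ht1 : 0 < t := by linarith
  have hL : 0 ≤ Real.log t := Real.log_nonneg (by linarith)
  have h1 : (S.card : ℝ) / t ^ 2 ≤ C * t * Real.log t / t ^ 2 := by gcongr
  have h2 : C * t * Real.log t / t ^ 2 = C * Real.log t / t := by field_simp
  have h3 : 2 * C * ((1 + Real.log t) / t) - C * Real.log t / t = C * (2 + Real.log t) / t := by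
    ring
  have h4 : 0 ≤ C * (2 + Real.log t) / t := by positivity
  linarith

lemma norm_pow_sub_pow_le {a b : ℂ} (ha : ‖a‖ ≤ 1) (hb : ‖b‖ ≤ 1) (n : ℕ) :
    ‖a ^ n - b ^ n‖ ≤ n * ‖a - b‖ := by
  induction n with
  | zero => simp
  | succ n ih =>
    have h : a ^ (n + 1) - b ^ (n + 1) = (a ^ n - b ^ n) * a + b ^ n * (a - b) := by ring
    rw [h]
    have hbn : ‖b ^ n‖ ≤ 1 := by
      rw [norm_pow]
      exact pow_le_one₀ (norm_nonneg b) hb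
    have h1 : ‖(a ^ n - b ^ n) * a‖ ≤ ‖a ^ n - b ^ n‖ := by
      rw [norm_mul]
      exact mul_le_of_le_one_right (norm_nonneg _) ha
    have h2 : ‖b ^ n * (a - b)‖ ≤ ‖a - b‖ := by
      rw [norm_mul]
      exact mul_le_of_le_one_left (norm_nonneg _) hbn
    push_cast
    linarith [norm_add_le ((a ^ n - b ^ n) * a) (b ^ n * (a - b))]

lemma norm_div_sub_le_one {z : ℂ} {τ : ℝ} (hτ : 0 ≤ τ) (hz : z.re ≤ τ / 2) :
    ‖z / (z - (τ : ℂ))‖ ≤ 1 := by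
  rw [norm_div]
  refine div_le_one_of_le₀ ?_ (norm_nonneg _)
  rw [← sq_le_sq₀ (norm_nonneg _) (norm_nonneg _), Complex.sq_norm, Complex.sq_norm,
    Complex.normSq_apply, Complex.normSq_apply]
  simp only [Complex.sub_re, Complex.sub_im, Complex.ofReal_re, Complex.ofReal_im]
  nlinarith

lemma norm_li_term_sub_le {z w : ℂ} {τ ϑ : ℝ} (hτ : 0 ≤ τ) (hϑ0 : 0 ≤ ϑ) (hϑ1 : ϑ < 1)
    (hz : z.re ≤ τ / 2) (hw : w.re ≤ τ / 2) (him : 1 ≤ |z.im|) (hzw : ‖z - w‖ ≤ ϑ) (n : ℕ) :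
    ‖(z / (z - (τ : ℂ))) ^ n - (w / (w - (τ : ℂ))) ^ n‖ ≤
      n * τ * ϑ / (1 - ϑ) * (1 / |z.im| ^ 2) := by
  have hz0 : 0 < |z.im| := by linarith
  have hϑ : 0 < 1 - ϑ := by linarith
  have hwim : |z.im| * (1 - ϑ) ≤ |w.im| := by
    have h1 : |z.im - w.im| ≤ ϑ := by simpa using (Complex.abs_im_le_norm (z - w)).trans hzw
    have h2 := abs_sub_abs_le_abs_sub z.im w.im
    nlinarith
  have hzn : |z.im| ≤ ‖z - (τ : ℂ)‖ := by simpa using Complex.abs_im_le_norm (z - (τ : ℂ))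
  have hwn : |z.im| * (1 - ϑ) ≤ ‖w - (τ : ℂ)‖ :=
    hwim.trans (by simpa using Complex.abs_im_le_norm (w - (τ : ℂ)))
  have hz1 : z - (τ : ℂ) ≠ 0 := norm_pos_iff.1 (by linarith)
  have hw1 : w - (τ : ℂ) ≠ 0 := norm_pos_iff.1 (lt_of_lt_of_le (by positivity) hwn)
  have heq : z / (z - (τ : ℂ)) - w / (w - (τ : ℂ)) =
      -(τ * (z - w)) / ((z - (τ : ℂ)) * (w - (τ : ℂ))) := by
    field_simp
    ring
  have hdiff : ‖z / (z - (τ : ℂ)) - w / (w - (τ : ℂ))‖ ≤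
      τ * ϑ / (|z.im| * (|z.im| * (1 - ϑ))) := by
    rw [heq, norm_div, norm_neg, norm_mul, norm_mul, Complex.norm_real, Real.norm_of_nonneg hτ]
    gcongr
  calc _ ≤ n * ‖z / (z - (τ : ℂ)) - w / (w - (τ : ℂ))‖ :=
        norm_pow_sub_pow_le (norm_div_sub_le_one hτ hz) (norm_div_sub_le_one hτ hw) n
    _ ≤ n * (τ * ϑ / (|z.im| * (|z.im| * (1 - ϑ)))) := by gcongr
    _ = _ := by field_simp

/-- Abstract approximation error estimate: if `(ρ_k)` is a family of zeros
in the upper half-plane `Im ρ_k ≥ t₀ ≥ 1` with `Re ρ_k ≤ τ/2`, whose counting function is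
bounded by `C·t·log t`, and `(ρ'_k)` are approximations with the same real parts and
`|ρ_k − ρ'_k| ≤ ϑ < 1`, then the total discrepancy in the truncated Li-type sums (over the
zeros together with their conjugates) is at most `4·C·ϑ·n·τ·(1 + log t₀)/(t₀·(1−ϑ))`. -/
theorem approximation_error_estimate {I : Type*} [Countable I]
    (t0 C ϑ τ : ℝ) (ht0 : 1 ≤ t0) (hC : 0 < C) (hϑ0 : 0 < ϑ) (hϑ1 : ϑ < 1) (hτ : 0 < τ)
    (ρ ρ' : I → ℂ)
    (him : ∀ k, t0 ≤ (ρ k).im) (hre : ∀ k, (ρ k).re ≤ τ / 2)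
    (hcount : ∀ t : ℝ, t0 ≤ t →
      ∃ hfin : {k : I | (ρ k).im ≤ t}.Finite, (hfin.toFinset.card : ℝ) ≤ C * t * Real.log t)
    (hre' : ∀ k, (ρ' k).re = (ρ k).re) (happ : ∀ k, ‖ρ k - ρ' k‖ ≤ ϑ)
    (n : ℕ) (hn : 0 < n) (T : ℝ) :
    ‖∑' k : {k : I // (ρ k).im ≤ T},
        (((ρ k.1 / (ρ k.1 - (τ : ℂ))) ^ n - (ρ' k.1 / (ρ' k.1 - (τ : ℂ))) ^ n) +
         (((starRingEnd ℂ) (ρ k.1) / ((starRingEnd ℂ) (ρ k.1) - (τ : ℂ))) ^ n -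
          ((starRingEnd ℂ) (ρ' k.1) / ((starRingEnd ℂ) (ρ' k.1) - (τ : ℂ))) ^ n))‖ ≤
      4 * C * ϑ * n * τ * (1 + Real.log t0) / (t0 * (1 - ϑ)) := by
  obtain ⟨hfin, -⟩ := hcount (max t0 T) (le_max_left _ _)
  have hfinite : Finite {k : I // (ρ k).im ≤ T} :=
    (hfin.subset fun k (hk : (ρ k).im ≤ T) => hk.trans (le_max_right t0 T)).to_subtype
  have := Fintype.ofFinite {k : I // (ρ k).im ≤ T}
  have hcard : ∀ t, t0 ≤ t → ((Finset.univ.filter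
      (fun k : {k : I // (ρ k).im ≤ T} => (ρ k.1).im ≤ t)).card : ℝ) ≤ C * t * Real.log t := by
    intro t ht
    obtain ⟨hf, hle⟩ := hcount t ht
    refine le_trans ?_ hle
    exact_mod_cast Finset.card_le_card_of_injOn Subtype.val
      (fun k hk => by simpa using hk) Subtype.val_injective.injOn
  have hsum := sum_inv_sq_le (fun k : {k : I // (ρ k).im ≤ T} => (ρ k.1).im) ht0 hC.le
    (fun k => him k.1) Finset.univ hcard (le_max_left t0 T)
    (fun k _ => k.2.trans (le_max_right t0 T))
  have hϑ : 0 < 1 - ϑ := by linarith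
  have ht0' : 0 < t0 := by linarith
  have hterm : ∀ k, ‖((ρ k / (ρ k - (τ : ℂ))) ^ n - (ρ' k / (ρ' k - (τ : ℂ))) ^ n) +
         (((starRingEnd ℂ) (ρ k) / ((starRingEnd ℂ) (ρ k) - (τ : ℂ))) ^ n -
          ((starRingEnd ℂ) (ρ' k) / ((starRingEnd ℂ) (ρ' k) - (τ : ℂ))) ^ n)‖ ≤
      2 * (n * τ * ϑ / (1 - ϑ)) * (1 / (ρ k).im ^ 2) := by
    intro k
    have him1 : 1 ≤ |(ρ k).im| := (ht0.trans (him k)).trans (le_abs_self _)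
    have h1 := norm_li_term_sub_le hτ.le hϑ0.le hϑ1 (hre k) ((hre' k).trans_le (hre k)) him1
      (happ k) n
    have h2 := norm_li_term_sub_le (z := (starRingEnd ℂ) (ρ k)) (w := (starRingEnd ℂ) (ρ' k))
      hτ.le hϑ0.le hϑ1 (by simpa using hre k) (by simpa using (hre' k).trans_le (hre k))
      (by simpa using him1) (by rw [← map_sub, Complex.norm_conj]; exact happ k) n
    rw [Complex.conj_im, abs_neg] at h2
    rw [sq_abs] at h1 h2
    refine (norm_add_le _ _).trans ?_
    linarith
  rw [tsum_fintype]
  calc _ ≤ ∑ k : {k : I // (ρ k).im ≤ T},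
        2 * (n * τ * ϑ / (1 - ϑ)) * (1 / (ρ k.1).im ^ 2) :=
        norm_sum_le_of_le _ fun k _ => hterm k.1
    _ ≤ 2 * (n * τ * ϑ / (1 - ϑ)) * (2 * C * ((1 + Real.log t0) / t0)) := by
        rw [← Finset.mul_sum]
        gcongr
    _ = _ := by
        field_simp
        ring

end
end
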